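/- Let F be a family of nonempty compact convex sets in ℝ² such that every three members of F have a common line transversal (property T(3)). Then F is pierced by 3 lines. -/

import Mathlib

open Set

/-- The Euclidean plane ℝ². -/
abbrev Plane := EuclideanSpace ℝ (Fin 2)

/-- A line in the plane: a one-dimensional affine subspace of ℝ². -/
def IsLine (l : Set Plane) : Prop :=
  ∃ p v : Plane, v ≠ 0 ∧ l = {x | ∃ t : ℝ, x = p + t • v}

/-- A triple of sets `A, B, C` is tight if
`conv(A ∪ B) ∩ conv(A ∪ C) ∩ conv(B ∪ C) ≠ ∅`. -/
def Tight (A B C : Set Plane) : Prop :=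
  (convexHull ℝ (A ∪ B) ∩ convexHull ℝ (A ∪ C) ∩ convexHull ℝ (B ∪ C)).Nonempty

/-- A family `F` of sets in the plane is pierced by `k` lines if there are `k` lines
such that every member of `F` intersects their union. -/
def PiercedByLines (F : Set (Set Plane)) (k : ℕ) : Prop :=
  ∃ L : Fin k → Set Plane, (∀ i, IsLine (L i)) ∧ ∀ S ∈ F, (S ∩ ⋃ i, L i).Nonempty


section Scarf
open Classical

def SDom {I V : Type} (r : I → V → ℤ) (A : Finset V) : Prop :=
  ∀ y, ∃ i, ∀ a ∈ A, r i y ≤ r i a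

lemma SDom.mono {I V : Type} {r : I → V → ℤ} {A B : Finset V} (h : SDom r A) (hBA : B ⊆ A) :
    SDom r B := fun y => by
  obtain ⟨i, hi⟩ := h y
  exact ⟨i, fun a ha => hi a (hBA ha)⟩

lemma scarf_room {I V : Type} [Fintype I] [DecidableEq V] (c : V → I) (i0 : I) (A : Finset V)
    (hA : A.card = Fintype.card I) (hc : A.image c ≠ Finset.univ) :
    Even (A.filter (fun a => (A.erase a).image c = Finset.univ.erase i0)).card := by
  by_cases hex : ∃ a ∈ A, (A.erase a).image c = Finset.univ.erase i0
  swap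
  · push Not at hex
    rw [Finset.filter_eq_empty_iff.2 (fun a ha => hex a ha)]
    simp
  obtain ⟨a, ha, hac⟩ := hex
  have hinj : Set.InjOn c (A.erase a : Finset V) := by
    apply Finset.injOn_of_card_image_eq
    rw [hac, Finset.card_erase_of_mem (Finset.mem_univ _), Finset.card_erase_of_mem ha, hA,
      Finset.card_univ]
  have hca : c a ≠ i0 := by
    intro h
    apply hc
    rw [← Finset.insert_erase ha, Finset.image_insert, hac, h,
      Finset.insert_erase (Finset.mem_univ _)]
  have : c a ∈ (A.erase a).image c := by rw [hac]; simp [hca]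
  obtain ⟨b, hb, hbc⟩ := Finset.mem_image.1 this
  have hba : b ≠ a := (Finset.mem_erase.1 hb).1
  have hbA : b ∈ A := (Finset.mem_erase.1 hb).2
  have : A.filter (fun a => (A.erase a).image c = Finset.univ.erase i0) = {a, b} := by
    ext x
    simp only [Finset.mem_filter, Finset.mem_insert, Finset.mem_singleton]
    constructor
    · rintro ⟨hx, hxc⟩
      by_contra hne
      push Not at hne
      have hinj2 : Set.InjOn c (A.erase x : Finset V) := by
        apply Finset.injOn_of_card_image_eq
        rw [hxc, Finset.card_erase_of_mem (Finset.mem_univ _), Finset.card_erase_of_mem hx, hA,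
          Finset.card_univ]
      exact hba (hinj2 (by simp [hbA, hne.2.symm]) (by simp [ha, hne.1.symm]) hbc)
    · rintro (rfl | rfl)
      · exact ⟨ha, hac⟩
      · refine ⟨hbA, ?_⟩
        rw [← hac]
        ext k
        simp only [Finset.mem_image, Finset.mem_erase]
        constructor
        · rintro ⟨y, ⟨hy, hyA⟩, rfl⟩
          by_cases hya : y = a
          · exact ⟨x, ⟨hba, hbA⟩, by rw [hya, hbc]⟩
          · exact ⟨y, ⟨hya, hyA⟩, rfl⟩
        · rintro ⟨y, ⟨hy, hyA⟩, rfl⟩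
          by_cases hya : y = x
          · exact ⟨a, ⟨hba.symm, ha⟩, by rw [hya, hbc]⟩
          · exact ⟨y, ⟨hya, hyA⟩, rfl⟩
  rw [this, Finset.card_pair hba.symm]
  exact even_two

variable {I T : Type} [Fintype I] [Fintype T]

lemma scarf_door2 (r : I → T ⊕ I → ℤ) (hinj : ∀ i, Function.Injective (r i))
    (h1 : ∀ i t, r i (Sum.inr i) < r i (Sum.inl t))
    (h1' : ∀ i j, j ≠ i → r i (Sum.inr i) < r i (Sum.inr j))
    (h2 : ∀ i j t, j ≠ i → r i (Sum.inl t) < r i (Sum.inr j))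
    (D : Finset (T ⊕ I)) (hD : SDom r D) (hcard : D.card + 1 = Fintype.card I)
    (t0 : T) (ht0 : Sum.inl t0 ∈ D) :
    (Finset.univ.filter (fun A : Finset (T ⊕ I) =>
      (SDom r A ∧ A.card = Fintype.card I) ∧ D ⊆ A)).card = 2 := by
  have hm : ∀ i, ∃ m ∈ D, ∀ a ∈ D, r i m ≤ r i a := fun i =>
    Finset.exists_min_image D (r i) ⟨_, ht0⟩
  choose m hmD hmin using hm
  have hsurj : ∀ x ∈ D, ∃ i, m i = x := by
    intro x hx
    obtain ⟨i, hi⟩ := hD x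
    exact ⟨i, hinj i (le_antisymm (hmin i x hx) (hi _ (hmD i)))⟩
  obtain ⟨i, -, j, -, hij, hmij⟩ : ∃ x ∈ Finset.univ, ∃ y ∈ Finset.univ, x ≠ y ∧ m x = m y :=
    Finset.exists_ne_map_eq_of_card_lt_of_maps_to (t := D)
      (by rw [Finset.card_univ]; omega) (fun i _ => hmD i)
  have hmne : ∀ l k, k ≠ l → m l ≠ Sum.inr k := by
    intro l k hkl h
    have := hmin l _ ht0
    rw [h] at this
    have := h2 l k t0 hkl
    omega
  have hmem : ∀ k, Sum.inr k ∈ D → m k = Sum.inr k := by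
    intro k hk
    cases hmk : m k with
    | inl t =>
      have := hmin k _ hk
      rw [hmk] at this
      have := h1 k t
      omega
    | inr l =>
      by_cases hl : l = k
      · rw [hl]
      · exact absurd hmk (hmne k l hl)
  -- generic step
  have key : ∀ i j : I, i ≠ j → m i = m j → ∃ x, x ∉ D ∧ (∀ l, l ≠ i → r l (m l) < r l x) ∧
      r i x ≤ r i (m i) ∧
      (∀ z, (∀ l, l ≠ i → r l (m l) < r l z) → r i z ≤ r i x) ∧ SDom r (insert x D) := by
    intro i j hij hmij
    have hiD : Sum.inr i ∉ D := by
      intro h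
      have h3 := hmem i h
      rw [hmij] at h3
      exact hmne j i hij h3
    have hY : (Finset.univ.filter (fun y => ∀ l, l ≠ i → r l (m l) < r l y)).Nonempty := by
      refine ⟨Sum.inr i, ?_⟩
      simp only [Finset.mem_filter, Finset.mem_univ, true_and]
      intro l hl
      cases hml : m l with
      | inl t => exact h2 l i t hl.symm
      | inr k =>
        by_cases hk : k = l
        · rw [hk]; exact h1' l i hl.symm
        · exact absurd hml (hmne l k hk)
    obtain ⟨x, hx, hmax⟩ := Finset.exists_max_image _ (r i) hY
    simp only [Finset.mem_filter, Finset.mem_univ, true_and] at hx hmax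
    have hxi : r i x ≤ r i (m i) := by
      obtain ⟨l, hl⟩ := hD x
      by_cases hli : l = i
      · rw [← hli]; exact hl _ (hmD l)
      · have := hx l hli
        have := hl _ (hmD l)
        omega
    refine ⟨x, ?_, hx, hxi, hmax, ?_⟩
    · intro hxD
      obtain ⟨l, hl⟩ := hsurj x hxD
      by_cases hli : l = i
      · have := hx j hij.symm
        rw [← hl, hli, hmij] at this
        omega
      · have := hx l hli
        rw [← hl] at this
        omega
    · intro y
      by_cases hy : ∀ l, l ≠ i → r l (m l) < r l y
      · refine ⟨i, fun a ha => ?_⟩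
        rcases Finset.mem_insert.1 ha with rfl | ha
        · exact hmax y hy
        · exact (hmax y hy).trans (hxi.trans (hmin i a ha))
      · push Not at hy
        obtain ⟨l, hli, hl⟩ := hy
        refine ⟨l, fun a ha => ?_⟩
        rcases Finset.mem_insert.1 ha with rfl | ha
        · exact hl.trans (hx l hli).le
        · exact hl.trans (hmin l a ha)
  obtain ⟨x, hxD, hxY, hxi, hxmax, hxdom⟩ := key i j hij hmij
  obtain ⟨y, hyD, hyY, hyi, hymax, hydom⟩ := key j i hij.symm hmij.symm
  have hxy : x ≠ y := by
    rintro rfl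
    have := hyY i hij
    omega
  rw [Finset.card_eq_two]
  refine ⟨insert x D, insert y D, ?_, ?_⟩
  · intro h
    have : x ∈ insert y D := by rw [← h]; simp
    simp [hxy, hxD] at this
  ext A
  simp only [Finset.mem_filter, Finset.mem_univ, true_and, Finset.mem_insert, Finset.mem_singleton]
  constructor
  swap
  · rintro (rfl | rfl)
    · exact ⟨⟨hxdom, by rw [Finset.card_insert_of_notMem hxD, hcard]⟩, Finset.subset_insert _ _⟩
    · exact ⟨⟨hydom, by rw [Finset.card_insert_of_notMem hyD, hcard]⟩, Finset.subset_insert _ _⟩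
  rintro ⟨⟨hA, hAc⟩, hDA⟩
  obtain ⟨w, hwD, rfl⟩ : ∃ w, w ∉ D ∧ insert w D = A := by
    have := (Finset.covBy_iff_exists_insert (s := D) (t := A)).1
      (Finset.covBy_iff_card_sdiff_eq_one.2 ⟨hDA, by rw [Finset.card_sdiff_of_subset hDA]; omega⟩)
    obtain ⟨w, hw, h⟩ := this
    exact ⟨w, hw, h⟩
  -- every element is an argmin
  have hA1 : ∀ v ∈ insert w D, ∃ l, ∀ a ∈ insert w D, r l v ≤ r l a := fun v _ => hA v
  obtain ⟨l0, hl0⟩ := hA1 w (Finset.mem_insert_self _ _)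
  have hsub : D ⊆ (Finset.univ.erase l0).image m := by
    intro v hv
    obtain ⟨l, hl⟩ := hA1 v (Finset.mem_insert_of_mem hv)
    rw [Finset.mem_image]
    refine ⟨l, ?_, ?_⟩
    · rw [Finset.mem_erase]
      refine ⟨?_, Finset.mem_univ _⟩
      rintro rfl
      have e := hinj l (le_antisymm (hl0 v (Finset.mem_insert_of_mem hv))
        (hl w (Finset.mem_insert_self _ _)))
      exact hwD (e ▸ hv)
    · exact hinj l (le_antisymm (hmin l v hv) (hl _ (Finset.mem_insert_of_mem (hmD l))))
  have hl0ij : l0 = i ∨ l0 = j := by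
    by_contra hne
    push Not at hne
    have : D ⊆ ((Finset.univ.erase l0).erase j).image m := by
      intro v hv
      obtain ⟨l, hl, hlv⟩ := Finset.mem_image.1 (hsub hv)
      by_cases hlj : l = j
      · exact Finset.mem_image.2 ⟨i, by simp [hij, hne.1.symm], by rw [hmij, ← hlj, hlv]⟩
      · exact Finset.mem_image.2 ⟨l, by simp [hlj, (Finset.mem_erase.1 hl).1], hlv⟩
    have := Finset.card_le_card this
    have h3 := Finset.card_image_le (s := (Finset.univ.erase l0).erase j) (f := m)
    rw [Finset.card_erase_of_mem (by simp [hne.2.symm]), Finset.card_erase_of_mem (by simp),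
      Finset.card_univ] at h3
    have : 2 ≤ Fintype.card I := by
      have := Finset.card_pos.2 ⟨_, ht0⟩
      omega
    omega
  -- w in Y
  have hwY : ∀ l, l ≠ l0 → r l (m l) < r l w := by
    -- m injective on erase l0
    intro l hl
    by_contra hlt
    push Not at hlt
    have hlw : ∀ a ∈ insert w D, r l w ≤ r l a := by
      intro a ha
      rcases Finset.mem_insert.1 ha with rfl | ha
      · exact le_rfl
      · exact hlt.trans (hmin l a ha)
    have : D ⊆ ((Finset.univ.erase l0).erase l).image m := by
      intro v hv
      obtain ⟨k, hk⟩ := hA1 v (Finset.mem_insert_of_mem hv)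
      have hne : ∀ l', (∀ a ∈ insert w D, r l' w ≤ r l' a) → k ≠ l' := by
        rintro _ h rfl
        have e := hinj k (le_antisymm (h v (Finset.mem_insert_of_mem hv))
          (hk w (Finset.mem_insert_self _ _)))
        exact hwD (e ▸ hv)
      exact Finset.mem_image.2 ⟨k, by simp [hne l hlw, hne l0 hl0],
        hinj k (le_antisymm (hmin k v hv) (hk _ (Finset.mem_insert_of_mem (hmD k))))⟩
    have := Finset.card_le_card this
    have h3 := Finset.card_image_le (s := (Finset.univ.erase l0).erase l) (f := m)
    rw [Finset.card_erase_of_mem (by simp [hl]), Finset.card_erase_of_mem (by simp),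
      Finset.card_univ] at h3
    have : 2 ≤ Fintype.card I := by
      have := Finset.card_pos.2 ⟨_, ht0⟩
      omega
    omega
  have hwmax : ∀ z, (∀ l, l ≠ l0 → r l (m l) < r l z) → r l0 z ≤ r l0 w := by
    intro z hz
    obtain ⟨l, hl⟩ := hA z
    by_cases hll : l = l0
    · rw [← hll]; exact hl w (Finset.mem_insert_self _ _)
    · have := hz l hll
      have := hl _ (Finset.mem_insert_of_mem (hmD l))
      omega
  rcases hl0ij with rfl | rfl
  · left
    rw [hinj l0 (le_antisymm (hxmax w hwY) (hwmax x hxY))]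
  · right
    rw [hinj l0 (le_antisymm (hymax w hwY) (hwmax y hyY))]

theorem scarf [Nonempty T] [Nonempty I] (r : I → T ⊕ I → ℤ) (hinj : ∀ i, Function.Injective (r i))
    (h1 : ∀ i t, r i (Sum.inr i) < r i (Sum.inl t))
    (h1' : ∀ i j, j ≠ i → r i (Sum.inr i) < r i (Sum.inr j))
    (h2 : ∀ i j t, j ≠ i → r i (Sum.inl t) < r i (Sum.inr j))
    (c : T ⊕ I → I) (hc : ∀ i, c (Sum.inr i) = i) :
    ∃ A : Finset (T ⊕ I), SDom r A ∧ A.card = Fintype.card I ∧ A.image c = Finset.univ := by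
  by_contra hcon
  push Not at hcon
  obtain ⟨i0⟩ := ‹Nonempty I›
  set R : Finset (Finset (T ⊕ I)) := Finset.univ.filter
    (fun A => SDom r A ∧ A.card = Fintype.card I) with hR
  set DD : Finset (Finset (T ⊕ I)) := Finset.univ.filter
    (fun D => SDom r D ∧ D.card + 1 = Fintype.card I ∧ D.image c = Finset.univ.erase i0) with hDD
  have hcount := Finset.sum_card_bipartiteAbove_eq_sum_card_bipartiteBelow
    (s := R) (t := DD) (fun A D => D ⊆ A)
  set D0 : Finset (T ⊕ I) := (Finset.univ.erase i0).image Sum.inr with hD0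
  have hcardpos : 0 < Fintype.card I := Fintype.card_pos_iff.2 ⟨i0⟩
  have hD0card : D0.card + 1 = Fintype.card I := by
    rw [hD0, Finset.card_image_of_injective _ Sum.inr_injective,
      Finset.card_erase_of_mem (by simp), Finset.card_univ]
    omega
  obtain ⟨t, -, ht⟩ := Finset.exists_max_image (Finset.univ : Finset T)
    (fun t => r i0 (Sum.inl t)) Finset.univ_nonempty
  simp only [Finset.mem_univ, forall_const] at ht
  have hA0 : SDom r (insert (Sum.inl t) D0) := by
    intro y
    cases y with
    | inl s =>
      refine ⟨i0, fun a ha => ?_⟩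
      rcases Finset.mem_insert.1 ha with rfl | ha
      · exact ht s
      · obtain ⟨k, hk, rfl⟩ := Finset.mem_image.1 ha
        exact (h2 i0 k s (Finset.mem_erase.1 hk).1).le
    | inr k =>
      refine ⟨k, fun a ha => ?_⟩
      cases a with
      | inl s => exact (h1 k s).le
      | inr l =>
        by_cases hl : l = k
        · rw [hl]
        · exact (h1' k l hl).le
  have hD0mem : D0 ∈ DD := by
    rw [hDD, Finset.mem_filter]
    refine ⟨Finset.mem_univ _, hA0.mono (Finset.subset_insert _ _), hD0card, ?_⟩
    rw [hD0, Finset.image_image]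
    ext k
    simp [hc]
  have hodd : (R.bipartiteBelow (fun A D => D ⊆ A) D0).card = 1 := by
    rw [Finset.card_eq_one]
    refine ⟨insert (Sum.inl t) D0, ?_⟩
    ext A
    simp only [Finset.bipartiteBelow, hR, Finset.mem_filter, Finset.mem_univ, true_and,
      Finset.mem_singleton]
    constructor
    · rintro ⟨⟨hA, hAc⟩, hDA⟩
      obtain ⟨w, hwD, rfl⟩ : ∃ w, w ∉ D0 ∧ insert w D0 = A := by
        have := (Finset.covBy_iff_exists_insert (s := D0) (t := A)).1
          (Finset.covBy_iff_card_sdiff_eq_one.2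
            ⟨hDA, by rw [Finset.card_sdiff_of_subset hDA]; omega⟩)
        obtain ⟨w, hw, h⟩ := this
        exact ⟨w, hw, h⟩
      have hk : ∀ s : T, ∀ a ∈ insert w D0, r i0 (Sum.inl s) ≤ r i0 a := by
        intro s
        obtain ⟨l, hl⟩ := hA (Sum.inl s)
        by_cases hli : l = i0
        · rw [← hli]; exact hl
        · have := hl (Sum.inr l) (Finset.mem_insert_of_mem
            (Finset.mem_image.2 ⟨l, by simp [hli], rfl⟩))
          have := h1 l s
          omega
      have hw := hk t w (Finset.mem_insert_self _ _)
      cases w with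
      | inl s =>
        rw [hinj i0 (le_antisymm (ht s) hw)]
      | inr k =>
        exfalso
        by_cases hki : k = i0
        · rw [hki] at hw
          have := h1 i0 t
          omega
        · exact hwD (Finset.mem_image.2 ⟨k, by simp [hki], rfl⟩)
    · rintro rfl
      refine ⟨⟨hA0, ?_⟩, Finset.subset_insert _ _⟩
      rw [Finset.card_insert_of_notMem (by simp [hD0]), hD0card]
  have hother : ∀ D ∈ DD.erase D0, (R.bipartiteBelow (fun A D => D ⊆ A) D).card = 2 := by
    intro D hD
    obtain ⟨hne, hD⟩ := Finset.mem_erase.1 hD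
    rw [hDD, Finset.mem_filter] at hD
    obtain ⟨-, hdom, hcard, him⟩ := hD
    have : ∃ s : T, Sum.inl s ∈ D := by
      by_contra hno
      push Not at hno
      apply hne
      apply Finset.eq_of_subset_of_card_le
      · intro a ha
        cases a with
        | inl s => exact absurd ha (hno s)
        | inr k =>
          have : c (Sum.inr k) ∈ D.image c := Finset.mem_image_of_mem _ ha
          rw [him, hc] at this
          exact Finset.mem_image.2 ⟨k, this, rfl⟩
      · omega
    obtain ⟨s, hs⟩ := this
    have := scarf_door2 r hinj h1 h1' h2 D hdom hcard s hs
    rw [← this, hR, Finset.bipartiteBelow, Finset.filter_filter]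
  have hL : Even (∑ A ∈ R, (DD.bipartiteAbove (fun A D => D ⊆ A) A).card) := by
    apply Finset.even_sum
    intro A hA
    rw [hR, Finset.mem_filter] at hA
    have h3 := scarf_room c i0 A hA.2.2 (hcon A hA.2.1 hA.2.2)
    suffices hb : (A.filter (fun a => (A.erase a).image c = Finset.univ.erase i0)).card =
        (DD.bipartiteAbove (fun A D => D ⊆ A) A).card by
      rw [← hb]; exact h3
    apply Finset.card_bij (fun a _ => A.erase a)
    · intro a ha
      rw [Finset.mem_filter] at ha
      simp only [Finset.bipartiteAbove, hDD, Finset.mem_filter, Finset.mem_univ, true_and]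
      refine ⟨⟨hA.2.1.mono (Finset.erase_subset _ _), ?_, ha.2⟩, Finset.erase_subset _ _⟩
      rw [Finset.card_erase_of_mem ha.1, hA.2.2]
      omega
    · intro a ha b hb h
      rw [Finset.mem_filter] at ha hb
      by_contra hab
      have : a ∈ A.erase b := Finset.mem_erase.2 ⟨hab, ha.1⟩
      rw [← h] at this
      simp at this
    · intro D hD
      simp only [Finset.bipartiteAbove, hDD, Finset.mem_filter, Finset.mem_univ, true_and] at hD
      obtain ⟨⟨hdom, hcard, him⟩, hDA⟩ := hD
      obtain ⟨w, hwD, rfl⟩ : ∃ w, w ∉ D ∧ insert w D = A := by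
        have := (Finset.covBy_iff_exists_insert (s := D) (t := A)).1
          (Finset.covBy_iff_card_sdiff_eq_one.2
            ⟨hDA, by rw [Finset.card_sdiff_of_subset hDA, hA.2.2]; omega⟩)
        obtain ⟨w, hw, h⟩ := this
        exact ⟨w, hw, h⟩
      refine ⟨w, ?_, ?_⟩
      · simp [Finset.erase_insert hwD, him]
      · rw [Finset.erase_insert hwD]
  rw [hcount, ← Finset.add_sum_erase _ _ hD0mem, hodd, Finset.sum_congr rfl hother] at hL
  simp only [Finset.sum_const, smul_eq_mul] at hL
  rw [Nat.even_iff] at hL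
  omega

end Scarf

section KKM
open Classical Filter Topology

abbrev Grid (I : Type) [Fintype I] (N : ℕ) : Type := {x : I → Fin (N + 1) // ∑ i, (x i : ℕ) = N}

variable {I : Type} [Fintype I]

lemma grid_exists (N : ℕ) (y : I → ℕ) (hy : ∑ i, y i = N) : ∃ x : Grid I N, ∀ i, (x.1 i : ℕ) = y i := by
  have : ∀ i, y i < N + 1 := by
    intro i
    have := Finset.single_le_sum (f := y) (fun j _ => Nat.zero_le _) (Finset.mem_univ i)
    omega
  exact ⟨⟨fun i => ⟨y i, this i⟩, hy⟩, fun i => rfl⟩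

lemma grid_exists_le [Nonempty I] (N : ℕ) (q : I → ℕ) (hq : ∑ i, q i ≤ N) :
    ∃ x : Grid I N, ∀ i, q i ≤ (x.1 i : ℕ) := by
  obtain ⟨i1⟩ := ‹Nonempty I›
  obtain ⟨x, hx⟩ := grid_exists N (fun i => q i + if i = i1 then N - ∑ i, q i else 0) (by
    rw [Finset.sum_add_distrib]
    simp
    omega)
  exact ⟨x, fun i => by rw [hx]; omega⟩

lemma grid_color [Nonempty I] (N : ℕ) (c : Grid I N → I) :
    ∃ p : I → Grid I N, (∀ i, c (p i) = i ∨ ((p i).1 i : ℕ) ≤ Fintype.card I) ∧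
      ∀ i j k, ((p i).1 k : ℕ) ≤ (p j).1 k + Fintype.card I := by
  obtain ⟨x0, -⟩ := grid_exists_le (I := I) N (fun _ => 0) (by simp)
  have : Nonempty (Grid I N) := ⟨x0⟩
  set M := Fintype.card (Grid I N) with hM
  let enc : Grid I N ≃ Fin M := Fintype.equivFin _
  let eI : I ≃ Fin (Fintype.card I) := Fintype.equivFin _
  let r : I → Grid I N ⊕ I → ℤ := fun i => Sum.elim
    (fun x => ((x.1 i : ℕ) : ℤ) * M + ((enc x : ℕ) : ℤ))
    (fun j => if j = i then -1 else (N + 1) * M + ((eI j : ℕ) : ℤ))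
  have hlt : ∀ i (x : Grid I N), ((x.1 i : ℕ) : ℤ) * M + ((enc x : ℕ) : ℤ) < (N + 1) * M := by
    intro i x
    have h1 : ((enc x : ℕ) : ℤ) < M := by exact_mod_cast (enc x).2
    have h2 : ((x.1 i : ℕ) : ℤ) ≤ N := by
      have := (x.1 i).2
      omega
    nlinarith
  have hle : ∀ i (x y : Grid I N), r i (Sum.inl x) ≤ r i (Sum.inl y) → (x.1 i : ℕ) ≤ y.1 i := by
    intro i x y h
    by_contra hc
    push Not at hc
    have h1 : ((enc y : ℕ) : ℤ) < M := by exact_mod_cast (enc y).2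
    have h2 : ((y.1 i : ℕ) : ℤ) + 1 ≤ (x.1 i : ℕ) := by exact_mod_cast hc
    simp only [r, Sum.elim_inl] at h
    have : (0 : ℤ) ≤ ((enc x : ℕ) : ℤ) := by positivity
    nlinarith
  have h1 : ∀ i t, r i (Sum.inr i) < r i (Sum.inl t) := by
    intro i t
    simp only [r, Sum.elim_inl, Sum.elim_inr, if_true]
    have : (0 : ℤ) ≤ ((t.1 i : ℕ) : ℤ) * M + ((enc t : ℕ) : ℤ) := by positivity
    omega
  have h1' : ∀ i j, j ≠ i → r i (Sum.inr i) < r i (Sum.inr j) := by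
    intro i j hj
    simp only [r, Sum.elim_inr, if_true, if_neg hj]
    have : (0 : ℤ) ≤ (N + 1) * M + ((eI j : ℕ) : ℤ) := by positivity
    omega
  have h2 : ∀ i j t, j ≠ i → r i (Sum.inl t) < r i (Sum.inr j) := by
    intro i j t hj
    simp only [r, Sum.elim_inr, Sum.elim_inl, if_neg hj]
    have := hlt i t
    have : (0 : ℤ) ≤ ((eI j : ℕ) : ℤ) := by positivity
    linarith
  have hinj : ∀ i, Function.Injective (r i) := by
    intro i a b hab
    cases a with
    | inl x =>
      cases b with
      | inl y =>
        have e1 := le_antisymm (hle i x y hab.le) (hle i y x hab.ge)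
        simp only [r, Sum.elim_inl, e1] at hab
        have : (enc x : ℕ) = enc y := by
          have := add_left_cancel hab
          exact_mod_cast this
        rw [enc.injective (Fin.ext this)]
      | inr k =>
        by_cases hk : k = i
        · subst hk; exact absurd hab (h1 k x).ne'
        · exact absurd hab (h2 i k x hk).ne
    | inr l =>
      cases b with
      | inl y =>
        by_cases hk : l = i
        · subst hk; exact absurd hab (h1 l y).ne
        · exact absurd hab (h2 i l y hk).ne'
      | inr k =>
        by_cases hk : k = i
        · by_cases hl : l = i
          · rw [hk, hl]
          · subst hk; exact absurd hab (h1' _ _ hl).ne'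
        · by_cases hl : l = i
          · subst hl; exact absurd hab (h1' _ _ hk).ne
          · simp only [r, Sum.elim_inr, if_neg hk, if_neg hl] at hab
            have : (eI l : ℕ) = eI k := by
              have := add_left_cancel hab
              exact_mod_cast this
            rw [eI.injective (Fin.ext this)]
  obtain ⟨A, hA, hAcard, hAc⟩ := scarf r hinj h1 h1' h2 (Sum.elim c id) (fun i => rfl)
  have hdom : ∀ y : Grid I N, ∃ i, Sum.inr i ∉ A ∧ ∀ x, Sum.inl x ∈ A → (y.1 i : ℕ) ≤ x.1 i := by
    intro y
    obtain ⟨i, hi⟩ := hA (Sum.inl y)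
    refine ⟨i, fun h => ?_, fun x hx => hle i y x (hi _ hx)⟩
    have := hi _ h
    have := h1 i y
    omega
  have hσ : ∃ x : Grid I N, Sum.inl x ∈ A := by
    by_contra hno
    push Not at hno
    obtain ⟨i, hi, -⟩ := hdom x0
    have : i ∈ A.image (Sum.elim c id) := by rw [hAc]; simp
    obtain ⟨a, ha, hai⟩ := Finset.mem_image.1 this
    cases a with
    | inl x => exact hno x ha
    | inr k =>
      simp at hai
      rw [hai] at ha
      exact hi ha
  obtain ⟨xs, hxs⟩ := hσ
  have hmin : ∀ i, ∃ x : Grid I N, Sum.inl x ∈ A ∧ ∀ y : Grid I N, Sum.inl y ∈ A →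
      (x.1 i : ℕ) ≤ y.1 i := by
    intro i
    obtain ⟨x, hx, h⟩ := Finset.exists_min_image (Finset.univ.filter (fun x : Grid I N => Sum.inl x ∈ A))
      (fun x => (x.1 i : ℕ)) ⟨xs, by simp [hxs]⟩
    simp only [Finset.mem_filter, Finset.mem_univ, true_and] at hx h
    exact ⟨x, hx, h⟩
  choose m hmA hm using hmin
  set lo : I → ℕ := fun i => if Sum.inr i ∈ A then 0 else ((m i).1 i : ℕ) with hlo
  have hlole : ∀ x : Grid I N, Sum.inl x ∈ A → ∀ k, lo k ≤ x.1 k := by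
    intro x hx k
    simp only [hlo]
    split_ifs
    · exact Nat.zero_le _
    · exact hm k x hx
  have hsumlo : N < ∑ k, lo k + Fintype.card I := by
    by_contra hcon
    push Not at hcon
    obtain ⟨y, hy⟩ := grid_exists_le N (fun k => lo k + 1) (by
      rw [Finset.sum_add_distrib]; simpa using hcon)
    obtain ⟨i, hi, h⟩ := hdom y
    have a1 := hy i
    have a2 := h (m i) (hmA i)
    simp only [hlo, if_neg hi] at a1
    omega
  have hhi : ∀ x : Grid I N, Sum.inl x ∈ A → ∀ k, (x.1 k : ℕ) ≤ lo k + Fintype.card I := by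
    intro x hx k
    have hs := x.2
    rw [← Finset.add_sum_erase _ _ (Finset.mem_univ k)] at hs hsumlo
    have := Finset.sum_le_sum (s := Finset.univ.erase k) (fun i _ => hlole x hx i)
    omega
  have hp : ∀ i, ∃ x : Grid I N, Sum.inl x ∈ A ∧ (c x = i ∨ (x.1 i : ℕ) ≤ Fintype.card I) := by
    intro i
    have : i ∈ A.image (Sum.elim c id) := by rw [hAc]; simp
    obtain ⟨a, ha, hai⟩ := Finset.mem_image.1 this
    cases a with
    | inl x => exact ⟨x, ha, Or.inl hai⟩
    | inr k =>
      simp at hai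
      rw [hai] at ha
      refine ⟨xs, hxs, Or.inr ?_⟩
      have := hhi xs hxs i
      simpa [hlo, ha] using this
  choose p hpA hp using hp
  refine ⟨p, hp, fun i j k => ?_⟩
  have := hhi _ (hpA i) k
  have := hlole _ (hpA j) k
  omega

theorem kkm_closed [Nonempty I] (B : I → Set (I → ℝ)) (hB : ∀ i, IsClosed (B i))
    (hcov : ∀ x ∈ stdSimplex ℝ I, ∃ i, x ∈ B i)
    (hbd : ∀ x ∈ stdSimplex ℝ I, ∀ i, x i = 0 → x ∈ B i) :
    ∃ x ∈ stdSimplex ℝ I, ∀ i, x ∈ B i := by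
  let z : (N : ℕ) → Grid I (N + 1) → I → ℝ := fun N x i => ((x.1 i : ℕ) : ℝ) / (N + 1)
  have hz : ∀ N x, z N x ∈ stdSimplex ℝ I := by
    intro N x
    refine ⟨fun i => by positivity, ?_⟩
    simp only [z]
    rw [← Finset.sum_div, div_eq_one_iff_eq (by positivity)]
    exact_mod_cast x.2
  choose! col hcol using hcov
  have hP := fun N => grid_color (I := I) (N + 1) (fun x => col (z N x))
  choose p hp1 hp2 using hP
  obtain ⟨i1⟩ := id ‹Nonempty I›
  obtain ⟨x, hx, φ, hφ, hlim⟩ := (isCompact_stdSimplex ℝ I).tendsto_subseq (fun N => hz N (p N i1))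
  have hz0 : Tendsto (fun N : ℕ => (Fintype.card I : ℝ) / ((φ N : ℝ) + 1)) atTop (𝓝 0) := by
    have := (tendsto_const_div_atTop_nhds_zero_nat (Fintype.card I : ℝ)).comp
      ((tendsto_add_atTop_nat 1).comp hφ.tendsto_atTop)
    refine this.congr (fun N => ?_)
    simp
  have hdiff : ∀ N i j k, z N (p N i) k ≤ z N (p N j) k + (Fintype.card I : ℝ) / ((N : ℝ) + 1) := by
    intro N i j k
    simp only [z]
    rw [← add_div]
    gcongr
    exact_mod_cast hp2 N i j k
  have hlim2 : ∀ i, Tendsto (fun N => z (φ N) (p (φ N) i)) atTop (𝓝 x) := by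
    intro i
    rw [tendsto_pi_nhds] at hlim ⊢
    intro k
    have hk := hlim k
    have l1 := hk.sub hz0
    have l2 := hk.add hz0
    rw [sub_zero] at l1
    rw [add_zero] at l2
    refine tendsto_of_tendsto_of_tendsto_of_le_of_le l1 l2 (fun N => ?_) (fun N => ?_)
    · have := hdiff (φ N) i1 i k
      simp only [Function.comp]
      linarith
    · exact hdiff (φ N) i i1 k
  refine ⟨x, hx, fun i => ?_⟩
  by_cases hf : ∃ᶠ N in atTop, z (φ N) (p (φ N) i) ∈ B i
  · exact (hB i).mem_of_frequently_of_tendsto hf (hlim2 i)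
  · rw [not_frequently] at hf
    apply hbd x hx i
    apply le_antisymm _ (hx.1 i)
    have l := (tendsto_pi_nhds.1 (hlim2 i)) i
    refine le_of_tendsto_of_tendsto l hz0 ?_
    filter_upwards [hf] with N hN
    rcases hp1 (φ N) i with h | h
    · exfalso
      apply hN
      have := hcol _ (hz (φ N) (p (φ N) i))
      rwa [h] at this
    · simp only [z]
      gcongr
      
theorem kkm_open [Nonempty I] (A : I → Set (I → ℝ)) (hA : ∀ i, IsOpen (A i))
    (hAne : ∀ i, (A i)ᶜ.Nonempty)
    (hcov : ∀ x ∈ stdSimplex ℝ I, ∃ i, x ∈ A i)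
    (hbd : ∀ x ∈ stdSimplex ℝ I, ∀ i, x i = 0 → x ∉ A i) :
    ∃ x ∈ stdSimplex ℝ I, ∀ i, x ∈ A i := by
  let h : I → (I → ℝ) → ℝ := fun i x => Metric.infDist x (A i)ᶜ
  have hpos : ∀ i x, 0 < h i x ↔ x ∈ A i := by
    intro i x
    have := (hA i).isClosed_compl.notMem_iff_infDist_pos (hAne i) (x := x)
    simp only [h]
    rw [← this]; simp
  have hnn : ∀ i x, 0 ≤ h i x := fun i x => Metric.infDist_nonneg
  have hcont : ∀ i, Continuous (h i) := fun i => Metric.continuous_infDist_pt _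
  let Mx : (I → ℝ) → ℝ := fun x => Finset.univ.sup' Finset.univ_nonempty (fun i => h i x)
  have hMc : Continuous Mx := Continuous.finset_sup'_apply _ (fun i _ => hcont i)
  let g : I → (I → ℝ) → ℝ := fun i x => Mx x - h i x
  have hgc : ∀ i, Continuous (g i) := fun i => hMc.sub (hcont i)
  have hg0 : ∀ i x, 0 ≤ g i x := fun i x =>
    sub_nonneg.2 (Finset.le_sup' (fun i => h i x) (Finset.mem_univ i))
  let G : (I → ℝ) → ℝ := fun x => ∑ i, g i x
  have hGc : Continuous G := continuous_finsetSum _ (fun i _ => hgc i)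
  obtain ⟨x, hx, hxB⟩ := kkm_closed (fun i => {x : I → ℝ | x i * G x ≤ g i x})
    (fun i => isClosed_le ((continuous_apply i).mul hGc) (hgc i))
    (by
      intro x hx
      by_contra hcon
      push Not at hcon
      have : ∑ i, g i x < ∑ i, x i * G x :=
        Finset.sum_lt_sum_of_nonempty Finset.univ_nonempty (fun i _ => not_le.1 (hcon i))
      rw [← Finset.sum_mul, hx.2, one_mul] at this
      exact lt_irrefl _ this)
    (by
      intro x hx i hi
      simp [hi, hg0])
  refine ⟨x, hx, fun i => ?_⟩
  obtain ⟨i0, -, hi0⟩ := Finset.exists_mem_eq_sup' (Finset.univ_nonempty (α := I)) (fun i => h i x)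
  have hgi0 : g i0 x = 0 := sub_eq_zero.2 hi0
  obtain ⟨i2, hi2⟩ := hcov x hx
  have hMpos : 0 < h i0 x := by
    have h1 := (hpos i2 x).2 hi2
    have h2 := hg0 i2 x
    have h3 := hgi0
    simp only [g] at h2 h3
    linarith
  have hxi0 : x i0 ≠ 0 := fun h0 => hbd x hx i0 h0 ((hpos _ _).1 hMpos)
  have hGz : G x = 0 := by
    have h1 := hxB i0
    simp only [Set.mem_ofPred_eq, hgi0] at h1
    have h2 : 0 < x i0 := lt_of_le_of_ne (hx.1 i0) hxi0.symm
    have h3 : 0 ≤ G x := Finset.sum_nonneg (fun i _ => hg0 i x)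
    nlinarith
  have := (Finset.sum_eq_zero_iff_of_nonneg (fun i _ => hg0 i x)).1 hGz i (Finset.mem_univ i)
  rw [← hpos]
  simp only [g] at this hgi0
  linarith

end KKM

section Geom
open Filter Topology Real

noncomputable def ph (R α β : ℝ) (p : Plane) : ℝ :=
  p 0 * cos ((α + β) / 2) + p 1 * sin ((α + β) / 2) - R * cos ((β - α) / 2)

lemma ph_shift (R α β : ℝ) (p : Plane) : ph R β (α + 2 * π) p = - ph R α β p := by
  unfold ph
  rw [show (β + (α + 2 * π)) / 2 = (α + β) / 2 + π by ring,
    show (α + 2 * π - β) / 2 = π - (β - α) / 2 by ring, cos_add_pi, sin_add_pi, cos_pi_sub]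
  ring

lemma ph_mono (R α β γ : ℝ) (p : Plane) (hp : p 0 ^ 2 + p 1 ^ 2 ≤ R ^ 2) (hR : 0 ≤ R)
    (h1 : α ≤ β) (h2 : β ≤ γ) (h3 : γ ≤ α + 2 * π) (h : 0 < ph R α β p) : 0 ≤ ph R α γ p := by
  set X := p 0 * cos α + p 1 * sin α with hX
  set Y := p 1 * cos α - p 0 * sin α with hY
  have key : ∀ b, ph R α (α + 2 * b) p = - (R - X) * cos b + Y * sin b := by
    intro b
    unfold ph
    rw [show (α + (α + 2 * b)) / 2 = α + b by ring, show (α + 2 * b - α) / 2 = b by ring,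
      cos_add, sin_add, hX, hY]
    ring
  have hXR : X ≤ R := by
    have := sin_sq_add_cos_sq α
    apply le_of_sq_le_sq _ hR
    nlinarith [sq_nonneg Y]
  obtain ⟨b, rfl⟩ : ∃ b, β = α + 2 * b := ⟨(β - α) / 2, by ring⟩
  obtain ⟨c, rfl⟩ : ∃ c, γ = α + 2 * c := ⟨(γ - α) / 2, by ring⟩
  rw [key] at h ⊢
  have hb0 : 0 ≤ b := by linarith
  have hbc : b ≤ c := by linarith
  have hc : c ≤ π := by linarith
  have hsb : 0 ≤ sin b := sin_nonneg_of_nonneg_of_le_pi hb0 (by linarith)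
  have hsc : 0 ≤ sin c := sin_nonneg_of_nonneg_of_le_pi (by linarith) hc
  have hs : 0 ≤ sin (c - b) := sin_nonneg_of_nonneg_of_le_pi (by linarith) (by linarith)
  rw [sin_sub] at hs
  rcases hsb.eq_or_lt with h0 | h0
  · -- b = 0 or b = π
    rcases hb0.eq_or_lt with hb | hb
    · rw [← hb] at h
      simp at h
      linarith
    · have : b = π := by
        by_contra hne
        have := sin_pos_of_pos_of_lt_pi hb (lt_of_le_of_ne (by linarith) hne)
        linarith
      have : c = b := by linarith
      rw [this]; exact h.le
  · by_contra hcon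
    push Not at hcon
    have e1 := mul_nonneg (sub_nonneg.2 hXR) hs
    have e2 := mul_nonneg h.le hsc
    have e3 := mul_neg_of_pos_of_neg h0 hcon
    nlinarith

lemma ph_cont (R : ℝ) {X : Type} [TopologicalSpace X] (a b : X → ℝ) (ha : Continuous a)
    (hb : Continuous b) : Continuous (fun q : X × Plane => ph R (a q.1) (b q.1) q.2) := by
  unfold ph
  fun_prop

lemma open_forall {X : Type} [TopologicalSpace X] (f : X × Plane → ℝ) (hf : Continuous f)
    (S : Set Plane) (hS : IsCompact S) : IsOpen {x | ∀ p ∈ S, 0 < f (x, p)} := by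
  rw [isOpen_iff_mem_nhds]
  intro x hx
  apply hS.eventually_forall_of_forall_eventually
  intro p hp
  exact (hf.tendsto (x, p)).eventually (lt_mem_nhds (hx p hp))

lemma open_family {X : Type} [TopologicalSpace X] (f g h : X × Plane → ℝ) (hf : Continuous f)
    (hg : Continuous g) (hh : Continuous h) (F : Set (Set Plane)) (hF : ∀ S ∈ F, IsCompact S) :
    IsOpen {x | ∃ S ∈ F, (∀ p ∈ S, 0 < f (x, p)) ∧ (∀ p ∈ S, 0 < g (x, p)) ∧
      ((∀ p ∈ S, 0 < h (x, p)) ∨ (∀ p ∈ S, 0 < - h (x, p)))} := by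
  have : {x | ∃ S ∈ F, (∀ p ∈ S, 0 < f (x, p)) ∧ (∀ p ∈ S, 0 < g (x, p)) ∧
      ((∀ p ∈ S, 0 < h (x, p)) ∨ (∀ p ∈ S, 0 < - h (x, p)))} =
      ⋃ S ∈ F, ({x | ∀ p ∈ S, 0 < f (x, p)} ∩ ({x | ∀ p ∈ S, 0 < g (x, p)} ∩
       ({x | ∀ p ∈ S, 0 < h (x, p)} ∪ {x | ∀ p ∈ S, 0 < - h (x, p)}))) := by
    ext x
    rw [mem_iUnion₂]
    constructor
    · rintro ⟨S, hS, h⟩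
      exact ⟨S, hS, h⟩
    · rintro ⟨S, hS, h⟩
      exact ⟨S, hS, h⟩
  rw [this]
  exact isOpen_biUnion (fun S hS => (open_forall f hf S (hF S hS)).inter
    ((open_forall g hg S (hF S hS)).inter ((open_forall h hh S (hF S hS)).union
      (open_forall (fun q => - h q) hh.neg S (hF S hS)))))

lemma sign_const (S : Set Plane) (hS : Convex ℝ S) (f : Plane → ℝ) (hf : Continuous f)
    (h0 : ∀ p ∈ S, f p ≠ 0) : (∀ p ∈ S, 0 < f p) ∨ (∀ p ∈ S, 0 < - f p) := by
  by_contra hcon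
  push Not at hcon
  obtain ⟨⟨p, hp, hp0⟩, q, hq, hq0⟩ := hcon
  have := hS.isPreconnected.intermediate_value hp hq hf.continuousOn
  obtain ⟨s, hs, hs0⟩ := this ⟨hp0, by linarith⟩
  exact h0 s hs hs0

lemma betw (A B s t u : ℝ) (h1 : s ≤ t) (h2 : t ≤ u) (hs : 0 < A + s * B) (hu : 0 < A + u * B) :
    0 < A + t * B := by
  rcases le_total 0 B with h | h <;> nlinarith

lemma betw3 (s t u : ℝ) : (s ≤ t ∧ t ≤ u ∨ u ≤ t ∧ t ≤ s) ∨ (t ≤ s ∧ s ≤ u ∨ u ≤ s ∧ s ≤ t) ∨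
    (s ≤ u ∧ u ≤ t ∨ t ≤ u ∧ u ≤ s) := by
  rcases le_total s t with h1 | h1 <;> rcases le_total t u with h2 | h2 <;>
  rcases le_total s u with h3 | h3 <;> simp [h1, h2, h3]

lemma betw' (A B s t u : ℝ) (h : s ≤ t ∧ t ≤ u ∨ u ≤ t ∧ t ≤ s) (hs : 0 < A + s * B)
    (hu : 0 < A + u * B) : 0 < A + t * B := by
  rcases h with h | h
  · exact betw A B s t u h.1 h.2 hs hu
  · exact betw A B u t s h.1 h.2 hu hs

/-- three sets with sign patterns +--, +++, --+ have no common line -/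
lemma no_trans (f1 f2 f3 : Plane → ℝ)
    (h1 : ∀ P v : Plane, ∃ A B : ℝ, ∀ t : ℝ, f1 (P + t • v) = A + t * B)
    (h2 : ∀ P v : Plane, ∃ A B : ℝ, ∀ t : ℝ, f2 (P + t • v) = A + t * B)
    (h3 : ∀ P v : Plane, ∃ A B : ℝ, ∀ t : ℝ, f3 (P + t • v) = A + t * B)
    (S1 S2 S3 l : Set Plane) (hl : IsLine l)
    (i1 : (S1 ∩ l).Nonempty) (i2 : (S2 ∩ l).Nonempty) (i3 : (S3 ∩ l).Nonempty)
    (s11 : ∀ p ∈ S1, 0 < f1 p) (s12 : ∀ p ∈ S1, 0 < - f2 p) (s13 : ∀ p ∈ S1, 0 < - f3 p)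
    (s21 : ∀ p ∈ S2, 0 < f1 p) (s22 : ∀ p ∈ S2, 0 < f2 p) (s23 : ∀ p ∈ S2, 0 < f3 p)
    (s31 : ∀ p ∈ S3, 0 < - f1 p) (s32 : ∀ p ∈ S3, 0 < - f2 p) (s33 : ∀ p ∈ S3, 0 < f3 p) :
    False := by
  obtain ⟨P, v, -, rfl⟩ := hl
  obtain ⟨_, hs, s, rfl⟩ := i1
  obtain ⟨_, ht, t, rfl⟩ := i2
  obtain ⟨_, hu, u, rfl⟩ := i3
  obtain ⟨A1, B1, e1⟩ := h1 P v
  obtain ⟨A2, B2, e2⟩ := h2 P v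
  obtain ⟨A3, B3, e3⟩ := h3 P v
  have s11 := s11 _ hs
  have s12 := s12 _ hs
  have s13 := s13 _ hs
  have s21 := s21 _ ht
  have s22 := s22 _ ht
  have s23 := s23 _ ht
  have s31 := s31 _ hu
  have s32 := s32 _ hu
  have s33 := s33 _ hu
  rw [e1] at s11 s21 s31
  rw [e2] at s12 s22 s32
  rw [e3] at s13 s23 s33
  rcases betw3 s t u with h | h | h
  · have := betw' (-A2) (-B2) s t u h (by linarith) (by linarith)
    linarith
  · have := betw' A3 B3 t s u h (by linarith) (by linarith)
    linarith
  · have := betw' A1 B1 s u t h (by linarith) (by linarith)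
    linarith

lemma ph_aff (R α β : ℝ) (P v : Plane) : ∃ A B : ℝ, ∀ t : ℝ, ph R α β (P + t • v) = A + t * B := by
  refine ⟨ph R α β P, v 0 * cos ((α + β) / 2) + v 1 * sin ((α + β) / 2), fun t => ?_⟩
  simp [ph]
  ring

lemma neg_aff (f : Plane → ℝ)
    (h : ∀ P v : Plane, ∃ A B : ℝ, ∀ t : ℝ, f (P + t • v) = A + t * B) (P v : Plane) :
    ∃ A B : ℝ, ∀ t : ℝ, - f (P + t • v) = A + t * B := by
  obtain ⟨A, B, h⟩ := h P v
  exact ⟨-A, -B, fun t => by rw [h]; ring⟩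

/-- the two triangles cannot both be nonempty -/
lemma no_both (R : ℝ) (a b c d e f : ℝ) (p q : Plane)
    (h12 : 0 < (b + e) / 2 - (a + d) / 2) (h23 : 0 < (c + f) / 2 - (b + e) / 2)
    (h13 : (c + f) / 2 - (a + d) / 2 < π)
    (p1 : 0 < ph R a d p) (p2 : 0 < - ph R b e p) (p3 : 0 < ph R c f p)
    (q1 : 0 < - ph R a d q) (q2 : 0 < ph R b e q) (q3 : 0 < - ph R c f q) : False := by
  have s1 : 0 < sin ((c + f) / 2 - (b + e) / 2) := sin_pos_of_pos_of_lt_pi h23 (by linarith)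
  have s2 : 0 < sin ((c + f) / 2 - (a + d) / 2) := sin_pos_of_pos_of_lt_pi (by linarith) h13
  have s3 : 0 < sin ((b + e) / 2 - (a + d) / 2) := sin_pos_of_pos_of_lt_pi h12 (by linarith)
  have key : sin ((c + f) / 2 - (b + e) / 2) * (ph R a d p - ph R a d q)
      + sin ((c + f) / 2 - (a + d) / 2) * (ph R b e q - ph R b e p)
      + sin ((b + e) / 2 - (a + d) / 2) * (ph R c f p - ph R c f q) = 0 := by
    unfold ph
    simp only [sin_sub]
    ring
  have := mul_pos s1 (show 0 < ph R a d p - ph R a d q by linarith)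
  have := mul_pos s2 (show 0 < ph R b e q - ph R b e p by linarith)
  have := mul_pos s3 (show 0 < ph R c f p - ph R c f q by linarith)
  linarith

lemma norm_cond (R : ℝ) (p : Plane) (hp : p ∈ Metric.closedBall (0 : Plane) R) :
    p 0 ^ 2 + p 1 ^ 2 ≤ R ^ 2 := by
  rw [mem_closedBall_zero_iff] at hp
  have h := EuclideanSpace.norm_sq_eq p
  simp only [Fin.sum_univ_two, Real.norm_eq_abs, sq_abs] at h
  rw [← h]
  have := norm_nonneg p
  gcongr

theorem bounded_case (F : Set (Set Plane)) (R : ℝ) (hR : 0 ≤ R)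
    (hFR : ∀ S ∈ F, S ⊆ Metric.closedBall 0 R)
    (hne : ∀ S ∈ F, S.Nonempty)
    (hcpt : ∀ S ∈ F, IsCompact S)
    (hconv : ∀ S ∈ F, Convex ℝ S)
    (hT3 : ∀ A ∈ F, ∀ B ∈ F, ∀ C ∈ F, ∃ l : Set Plane, IsLine l ∧
      (A ∩ l).Nonempty ∧ (B ∩ l).Nonempty ∧ (C ∩ l).Nonempty) :
    ∃ a b d : Fin 3 → ℝ, (∀ j, a j ^ 2 + b j ^ 2 = 1) ∧
      ∀ S ∈ F, ∃ j, ∃ p ∈ S, a j * p 0 + b j * p 1 = d j := by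
  by_contra hcon
  let th : ℕ → (Fin 6 → ℝ) → ℝ := fun k x => match k with
    | 1 => 2 * π * x 0
    | 2 => 2 * π * (x 0 + x 1)
    | 3 => 2 * π * (x 0 + x 1 + x 2)
    | 4 => 2 * π * (x 0 + x 1 + x 2 + x 3)
    | 5 => 2 * π * (x 0 + x 1 + x 2 + x 3 + x 4)
    | _ => 2 * π * (x 0 + x 1 + x 2 + x 3 + x 4 + x 5)
  have thc : ∀ k, Continuous (th k) := by
    intro k
    simp only [th]
    split <;> fun_prop
  let f1 : (Fin 6 → ℝ) × Plane → ℝ := fun q => ph R (th 1 q.1) (th 4 q.1) q.2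
  let f2 : (Fin 6 → ℝ) × Plane → ℝ := fun q => ph R (th 2 q.1) (th 5 q.1) q.2
  let f3 : (Fin 6 → ℝ) × Plane → ℝ := fun q => ph R (th 3 q.1) (th 6 q.1) q.2
  have c1 : Continuous f1 := ph_cont R _ _ (thc 1) (thc 4)
  have c2 : Continuous f2 := ph_cont R _ _ (thc 2) (thc 5)
  have c3 : Continuous f3 := ph_cont R _ _ (thc 3) (thc 6)
  let W : ((Fin 6 → ℝ) × Plane → ℝ) → ((Fin 6 → ℝ) × Plane → ℝ) →
      ((Fin 6 → ℝ) × Plane → ℝ) → Set (Fin 6 → ℝ) :=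
    fun f g h => {x | ∃ S ∈ F, (∀ p ∈ S, 0 < f (x, p)) ∧ (∀ p ∈ S, 0 < g (x, p)) ∧
      ((∀ p ∈ S, 0 < h (x, p)) ∨ (∀ p ∈ S, 0 < - h (x, p)))}
  let A : Fin 6 → Set (Fin 6 → ℝ) := ![W (-f1) (-f3) f2, W f1 (-f2) f3, W f2 (-f3) f1, W f1 f3 f2,
    W (-f1) f2 f3, W (-f2) f3 f1]
  have hAo : ∀ i, IsOpen (A i) := by
    intro i
    fin_cases i
    · exact open_family _ _ _ c1.neg c3.neg c2 F hcpt
    · exact open_family _ _ _ c1 c2.neg c3 F hcpt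
    · exact open_family _ _ _ c2 c3.neg c1 F hcpt
    · exact open_family _ _ _ c1 c3 c2 F hcpt
    · exact open_family _ _ _ c1.neg c2 c3 F hcpt
    · exact open_family _ _ _ c2.neg c3 c1 F hcpt
  have hpi := Real.pi_pos
  have hbd : ∀ x ∈ stdSimplex ℝ (Fin 6), ∀ i, x i = 0 → x ∉ A i := by
    intro x hx i hi hxA
    have hx0 := fun k => mul_nonneg hpi.le (hx.1 k)
    have hsum := hx.2
    simp only [Fin.sum_univ_six] at hsum
    have hsum' : π * x 0 + π * x 1 + π * x 2 + π * x 3 + π * x 4 + π * x 5 = π := by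
      linear_combination π * hsum
    have q0 := hx0 0
    have q1 := hx0 1
    have q2 := hx0 2
    have q3 := hx0 3
    have q4 := hx0 4
    have q5 := hx0 5
    have hi' : π * x i = 0 := by rw [hi, mul_zero]
    have main : ∀ S ∈ F, ∃ p ∈ S, p 0 ^ 2 + p 1 ^ 2 ≤ R ^ 2 := by
      intro S hS
      obtain ⟨p, hp⟩ := hne S hS
      exact ⟨p, hp, norm_cond R p (hFR S hS hp)⟩
    fin_cases i
    all_goals
      obtain ⟨S, hS, hf, hg, -⟩ := hxA
      obtain ⟨p, hpS, hp⟩ := main S hS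
      have hf := hf p hpS
      have hg := hg p hpS
      simp only [f1, f2, f3, Pi.neg_apply] at hf hg
    · have e : th 6 x = 0 + 2 * π := by simp only [th]; linarith
      have e' : th 1 x = 0 := by simp only [th]; simp at hi; rw [hi]; ring
      rw [e, ph_shift] at hg
      rw [e'] at hf
      have := ph_mono R 0 (th 3 x) (th 4 x) p hp hR (by simp only [th]; linarith)
        (by simp only [th]; linarith) (by simp only [th]; linarith) (by linarith)
      linarith
    · have e' : th 2 x = th 1 x := by simp only [th]; simp at hi; rw [hi]; ring
      rw [e'] at hg
      have := ph_mono R (th 1 x) (th 4 x) (th 5 x) p hp hR (by simp only [th]; linarith)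
        (by simp only [th]; linarith) (by simp only [th]; linarith) (by linarith)
      linarith
    · have e' : th 3 x = th 2 x := by simp only [th]; simp at hi; rw [hi]; ring
      rw [e'] at hg
      have := ph_mono R (th 2 x) (th 5 x) (th 6 x) p hp hR (by simp only [th]; linarith)
        (by simp only [th]; linarith) (by simp only [th]; linarith) (by linarith)
      linarith
    · have e' : th 4 x = th 3 x := by simp only [th]; simp at hi; rw [hi]; ring
      rw [e', ← neg_neg (ph _ _ _ _), ← ph_shift] at hf
      have := ph_mono R (th 3 x) (th 6 x) (th 1 x + 2 * π) p hp hR (by simp only [th]; linarith)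
        (by simp only [th]; linarith) (by simp only [th]; linarith) (by linarith)
      linarith
    · have e' : th 5 x = th 4 x := by simp only [th]; simp at hi; rw [hi]; ring
      rw [← ph_shift] at hf
      rw [e', ← neg_neg (ph _ _ _ _), ← ph_shift] at hg
      have := ph_mono R (th 4 x) (th 1 x + 2 * π) (th 2 x + 2 * π) p hp hR
        (by simp only [th]; linarith)
        (by simp only [th]; linarith) (by simp only [th]; linarith) (by linarith)
      linarith
    · have e' : th 6 x = th 5 x := by simp only [th]; simp at hi; rw [hi]; ring
      rw [← ph_shift] at hf
      rw [e', ← neg_neg (ph _ _ _ _), ← ph_shift] at hg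
      have := ph_mono R (th 5 x) (th 2 x + 2 * π) (th 3 x + 2 * π) p hp hR
        (by simp only [th]; linarith)
        (by simp only [th]; linarith) (by simp only [th]; linarith) (by linarith)
      linarith
  have hsgn : ∀ x, ∃ S ∈ F, ((∀ p ∈ S, 0 < f1 (x, p)) ∨ (∀ p ∈ S, 0 < - f1 (x, p))) ∧
      ((∀ p ∈ S, 0 < f2 (x, p)) ∨ (∀ p ∈ S, 0 < - f2 (x, p))) ∧
      ((∀ p ∈ S, 0 < f3 (x, p)) ∨ (∀ p ∈ S, 0 < - f3 (x, p))) := by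
    intro x
    by_contra hno
    apply hcon
    refine ⟨![cos ((th 1 x + th 4 x) / 2), cos ((th 2 x + th 5 x) / 2),
      cos ((th 3 x + th 6 x) / 2)], ![sin ((th 1 x + th 4 x) / 2), sin ((th 2 x + th 5 x) / 2),
      sin ((th 3 x + th 6 x) / 2)], ![R * cos ((th 4 x - th 1 x) / 2),
      R * cos ((th 5 x - th 2 x) / 2), R * cos ((th 6 x - th 3 x) / 2)], ?_, ?_⟩
    · intro j
      fin_cases j <;> exact cos_sq_add_sin_sq _
    · intro S hS
      by_contra hno2
      push Not at hno2
      apply hno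
      refine ⟨S, hS, ?_, ?_, ?_⟩
      · apply sign_const S (hconv S hS) (fun p => f1 (x, p)) (by fun_prop)
        intro p hp h0
        apply hno2 0 p hp
        simp only [f1, ph] at h0
        simp
        linarith
      · apply sign_const S (hconv S hS) (fun p => f2 (x, p)) (by fun_prop)
        intro p hp h0
        apply hno2 1 p hp
        simp only [f2, ph] at h0
        simp
        linarith
      · apply sign_const S (hconv S hS) (fun p => f3 (x, p)) (by fun_prop)
        intro p hp h0
        apply hno2 2 p hp
        simp only [f3, ph] at h0
        simp
        linarith
  have hcov : ∀ x ∈ stdSimplex ℝ (Fin 6), ∃ i, x ∈ A i := by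
    intro x _
    obtain ⟨S, hS, h1, h2, h3⟩ := hsgn x
    rcases id h1 with h1' | h1' <;> rcases id h2 with h2' | h2' <;> rcases id h3 with h3' | h3'
    · exact ⟨3, S, hS, h1', h3', h2⟩
    · exact ⟨2, S, hS, h2', h3', h1⟩
    · exact ⟨1, S, hS, h1', h2', h3⟩
    · exact ⟨1, S, hS, h1', h2', h3⟩
    · exact ⟨4, S, hS, h1', h2', h3⟩
    · exact ⟨4, S, hS, h1', h2', h3⟩
    · exact ⟨5, S, hS, h2', h3', h1⟩
    · exact ⟨0, S, hS, h1', h3', h2⟩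
  have hAne : ∀ i, (A i)ᶜ.Nonempty := by
    intro i
    refine ⟨Pi.single (i + 1) 1, hbd _ (single_mem_stdSimplex ℝ (i + 1)) i ?_⟩
    rw [Pi.single_apply, if_neg]
    fin_cases i <;> decide
  obtain ⟨x, hx, hxA⟩ := kkm_open A hAo hAne hcov hbd
  have hxpos : ∀ i, 0 < π * x i := fun i => mul_pos hpi
    (lt_of_le_of_ne (hx.1 i) (fun h => hbd x hx i h.symm (hxA i)))
  have hsum := hx.2
  simp only [Fin.sum_univ_six] at hsum
  have hsum' : π * x 0 + π * x 1 + π * x 2 + π * x 3 + π * x 4 + π * x 5 = π := by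
    linear_combination π * hsum
  have q0 := hxpos 0
  have q1 := hxpos 1
  have q2 := hxpos 2
  have q3 := hxpos 3
  have q4 := hxpos 4
  have q5 := hxpos 5
  have a1 := ph_aff R (th 1 x) (th 4 x)
  have a2 := ph_aff R (th 2 x) (th 5 x)
  have a3 := ph_aff R (th 3 x) (th 6 x)
  by_cases htri : ∃ p, 0 < f1 (x, p) ∧ 0 < - f2 (x, p) ∧ 0 < f3 (x, p)
  · obtain ⟨p, p1, p2, p3⟩ := htri
    have nb : ∀ S ∈ F, (∀ q ∈ S, 0 < - f1 (x, q)) → (∀ q ∈ S, 0 < f2 (x, q)) →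
        (∀ q ∈ S, 0 < - f3 (x, q)) → False := by
      intro S hS h1 h2 h3
      obtain ⟨q, hq⟩ := hne S hS
      exact no_both R (th 1 x) (th 2 x) (th 3 x) (th 4 x) (th 5 x) (th 6 x) p q
        (by simp only [th]; linarith) (by simp only [th]; linarith) (by simp only [th]; linarith)
        p1 p2 p3 (h1 q hq) (h2 q hq) (h3 q hq)
    obtain ⟨S1, hS1, u1, u2, u3⟩ := hxA 4
    obtain ⟨S2, hS2, v1, v3, v2⟩ := hxA 0
    obtain ⟨S3, hS3, w2, w3, w1⟩ := hxA 2
    replace u3 := u3.resolve_right (fun h => nb S1 hS1 u1 u2 h)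
    replace v2 := v2.resolve_left (fun h => nb S2 hS2 v1 h v3)
    replace w1 := w1.resolve_right (fun h => nb S3 hS3 h w2 w3)
    obtain ⟨l, hl, l1, l2, l3⟩ := hT3 S1 hS1 S2 hS2 S3 hS3
    exact no_trans (fun p => - f1 (x, p)) (fun p => - f2 (x, p)) (fun p => - f3 (x, p))
      (neg_aff _ a1) (neg_aff _ a2) (neg_aff _ a3) S1 S2 S3 l hl l1 l2 l3
      u1 (by simpa using u2) (by simpa using u3) v1 v2 v3
      (by simpa using w1) (by simpa using w2) w3
  · have nb : ∀ S ∈ F, (∀ q ∈ S, 0 < f1 (x, q)) → (∀ q ∈ S, 0 < - f2 (x, q)) →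
        (∀ q ∈ S, 0 < f3 (x, q)) → False := by
      intro S hS h1 h2 h3
      obtain ⟨q, hq⟩ := hne S hS
      exact htri ⟨q, h1 q hq, h2 q hq, h3 q hq⟩
    obtain ⟨S1, hS1, u1, u2, u3⟩ := hxA 1
    obtain ⟨S2, hS2, v1, v3, v2⟩ := hxA 3
    obtain ⟨S3, hS3, w2, w3, w1⟩ := hxA 5
    replace u3 := u3.resolve_left (fun h => nb S1 hS1 u1 u2 h)
    replace v2 := v2.resolve_right (fun h => nb S2 hS2 v1 h v3)
    replace w1 := w1.resolve_left (fun h => nb S3 hS3 h w2 w3)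
    obtain ⟨l, hl, l1, l2, l3⟩ := hT3 S1 hS1 S2 hS2 S3 hS3
    exact no_trans (fun p => f1 (x, p)) (fun p => f2 (x, p)) (fun p => f3 (x, p))
      a1 a2 a3 S1 S2 S3 l hl l1 l2 l3 u1 u2 u3 v1 v2 v3 w1 w2 w3

lemma isLine_eq (a b d : ℝ) (h : a ^ 2 + b ^ 2 = 1) :
    IsLine {p : Plane | a * p 0 + b * p 1 = d} := by
  refine ⟨!₂[d * a, d * b], !₂[-b, a], ?_, ?_⟩
  · intro h0
    have e0 := congrArg (fun q : Plane => q 0) h0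
    have e1 := congrArg (fun q : Plane => q 1) h0
    simp at e0 e1
    rw [e0, e1] at h
    norm_num at h
  · ext p
    constructor
    · intro hp
      change a * p 0 + b * p 1 = d at hp
      refine ⟨a * p 1 - b * p 0, ?_⟩
      ext i
      fin_cases i
      · simp
        rw [← hp]
        linear_combination -(p 0) * h
      · simp
        rw [← hp]
        linear_combination -(p 1) * h
    · rintro ⟨t, rfl⟩
      change a * _ + b * _ = d
      simp
      linear_combination d * h

lemma ultra_lim {X : Type} [TopologicalSpace X] {J : Type} (U : Ultrafilter J) (K : Set X)
    (hK : IsCompact K) (f : J → X) (hf : ∀ᶠ j in (U : Filter J), f j ∈ K) :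
    ∃ x ∈ K, Tendsto f U (𝓝 x) := by
  obtain ⟨x, hx, h⟩ := hK.ultrafilter_le_nhds (U.map f) (by
    rw [le_principal_iff]; exact hf)
  exact ⟨x, hx, h⟩

end Geom

theorem stmt_1 (F : Set (Set Plane))
    (hne : ∀ S ∈ F, S.Nonempty)
    (hcpt : ∀ S ∈ F, IsCompact S)
    (hconv : ∀ S ∈ F, Convex ℝ S)
    (hT3 : ∀ A ∈ F, ∀ B ∈ F, ∀ C ∈ F, ∃ l : Set Plane, IsLine l ∧
      (A ∩ l).Nonempty ∧ (B ∩ l).Nonempty ∧ (C ∩ l).Nonempty) :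
    PiercedByLines F 3 := by
  classical
  have hfin : ∀ G : Finset F, ∃ a b d : Fin 3 → ℝ, (∀ j, a j ^ 2 + b j ^ 2 = 1) ∧
      ∀ S ∈ G, ∃ j, ∃ p ∈ (S : Set Plane), a j * p 0 + b j * p 1 = d j := by
    intro G
    have hb : Bornology.IsBounded (⋃ S ∈ G, (S : Set Plane)) :=
      (Bornology.isBounded_biUnion_finset G).2 (fun S _ => (hcpt S S.2).isBounded)
    obtain ⟨R, hR, hsub⟩ := hb.subset_closedBall_lt 0 0
    have hGF : ∀ S ∈ ((fun S : F => (S : Set Plane)) '' (G : Set F)), S ∈ F := by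
      rintro _ ⟨S, -, rfl⟩
      exact S.2
    obtain ⟨a, b, d, h1, h2⟩ := bounded_case ((fun S : F => (S : Set Plane)) '' (G : Set F)) R hR.le
      (by
        rintro _ ⟨S, hS, rfl⟩
        exact (subset_iUnion₂_of_subset S hS (Subset.refl _)).trans hsub)
      (fun S hS => hne S (hGF S hS)) (fun S hS => hcpt S (hGF S hS))
      (fun S hS => hconv S (hGF S hS))
      (fun A hA B hB C hC => hT3 A (hGF A hA) B (hGF B hB) C (hGF C hC))
    exact ⟨a, b, d, h1, fun S hS => h2 S ⟨S, hS, rfl⟩⟩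
  choose a b d hab hhit using hfin
  let U : Ultrafilter (Finset F) := Ultrafilter.of Filter.atTop
  have hU : (U : Filter (Finset F)) ≤ Filter.atTop := Ultrafilter.of_le _
  have hal : ∀ j, ∃ x ∈ Icc (-1 : ℝ) 1, Filter.Tendsto (fun G => a G j) U (nhds x) := by
    intro j
    apply ultra_lim U _ isCompact_Icc
    refine Filter.Eventually.of_forall (fun G => abs_le.1 (abs_le_one_iff_mul_self_le_one.2 ?_))
    nlinarith [hab G j, sq_nonneg (b G j)]
  have hbl : ∀ j, ∃ x ∈ Icc (-1 : ℝ) 1, Filter.Tendsto (fun G => b G j) U (nhds x) := by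
    intro j
    apply ultra_lim U _ isCompact_Icc
    refine Filter.Eventually.of_forall (fun G => abs_le.1 (abs_le_one_iff_mul_self_le_one.2 ?_))
    nlinarith [hab G j, sq_nonneg (a G j)]
  choose a' _ ha' using hal
  choose b' _ hb' using hbl
  have hd : ∀ j, ∃ x : ℝ, ∀ y, Filter.Tendsto (fun G => d G j) U (nhds y) → x = y := by
    intro j
    by_cases h : ∃ y, Filter.Tendsto (fun G => d G j) U (nhds y)
    · obtain ⟨y, hy⟩ := h
      exact ⟨y, fun z hz => tendsto_nhds_unique hy hz⟩
    · exact ⟨0, fun y hy => absurd ⟨y, hy⟩ h⟩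
  choose d' hd' using hd
  refine ⟨fun j => {p : Plane | a' j * p 0 + b' j * p 1 = d' j}, fun j => ?_, fun S hS => ?_⟩
  · apply isLine_eq
    have := ((ha' j).pow 2).add ((hb' j).pow 2)
    refine tendsto_nhds_unique this ?_
    simp only [hab]
    exact tendsto_const_nhds
  · have hev : ∀ᶠ G in (U : Filter (Finset F)), (⟨S, hS⟩ : F) ∈ G :=
      hU (Filter.eventually_atTop.2 ⟨{⟨S, hS⟩}, fun G hG => hG (Finset.mem_singleton_self _)⟩)
    have hex : ∃ j, ∀ᶠ G in (U : Filter (Finset F)), ∃ p ∈ S, a G j * p 0 + b G j * p 1 = d G j := by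
      by_contra hno
      rw [not_exists] at hno
      have h2 : ∀ j, ∀ᶠ G in (U : Filter (Finset F)),
          ¬ ∃ p ∈ S, a G j * p 0 + b G j * p 1 = d G j := fun j =>
        Ultrafilter.eventually_not.2 (hno j)
      obtain ⟨G, h3, h4⟩ := ((Filter.eventually_all.2 h2).and hev).exists
      obtain ⟨j, hj⟩ := hhit G _ h4
      exact h3 j hj
    obtain ⟨j, hj⟩ := hex
    obtain ⟨p0, hp0⟩ := hne S hS
    have : ∀ G, ∃ p : Plane, (∃ p ∈ S, a G j * p 0 + b G j * p 1 = d G j) →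
        p ∈ S ∧ a G j * p 0 + b G j * p 1 = d G j := by
      intro G
      by_cases h : ∃ p ∈ S, a G j * p 0 + b G j * p 1 = d G j
      · obtain ⟨p, hp⟩ := h
        exact ⟨p, fun _ => hp⟩
      · exact ⟨p0, fun h' => absurd h' h⟩
    choose P hP using this
    obtain ⟨q, hq, hqlim⟩ := ultra_lim U S (hcpt S hS) P (hj.mono (fun G h => (hP G h).1))
    have l0 : Filter.Tendsto (fun G => P G 0) U (nhds (q 0)) :=
      ((by fun_prop : Continuous (fun q : Plane => q 0)).tendsto q).comp hqlim
    have l1 : Filter.Tendsto (fun G => P G 1) U (nhds (q 1)) :=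
      ((by fun_prop : Continuous (fun q : Plane => q 1)).tendsto q).comp hqlim
    have l2 := ((ha' j).mul l0).add ((hb' j).mul l1)
    have l3 := l2.congr' (hj.mono (fun G h => (hP G h).2))
    refine ⟨q, hq, mem_iUnion.2 ⟨j, ?_⟩⟩
    exact (hd' j _ l3).symm
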